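/- arXiv:1912.06909 — 2 statements merged into one kernel-verified Lean document; each statement's English description precedes it below -/
import Mathlib

section
/- For every preference profile P that is single-peaked with respect to ≺, every endowment profile ω, and every agent i such that ω_i ≺ ACR_i(P,ω), one has ACR_i(P,ω) = DCR_i(P,ω). -/
/- Preferences are given by rank functions: `rk i o` is agent `i`'s rank of object `o`
(lower rank = more preferred), so `o P_i o'` iff `rk i o < rk i o'`. -/

/-- Find the smallest index `t` such that the `t`-th agent prefers the `t`-th object
to the `(t+1)`-st object; the last index always qualifies. -/
def findIdx2 {n : ℕ} (rk : Fin n → Fin n → Fin n) : List (Fin n) → List (Fin n) → ℕ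
  | a :: as, o1 :: o2 :: os =>
      if rk a o1 < rk a o2 then 0 else findIdx2 rk as (o2 :: os) + 1
  | _, _ => 0

/-- One run of the (ascending) crawler: `agents` is the list of remaining agents in the
order of their current ownership, `objects` the list of remaining objects in increasing
`≺`-order (the `t`-th agent currently owns the `t`-th object). -/
def crawlAux {n : ℕ} (rk : Fin n → Fin n → Fin n) :
    ℕ → List (Fin n) → List (Fin n) → List (Fin n × Fin n)
  | 0, _, _ => []
  | fuel + 1, agents, objects =>
    match agents, objects with
    | a0 :: _, o0 :: _ =>
      let t := findIdx2 rk agents objects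
      let a := agents.getD t a0
      let ostar := (objects.argmin (rk a)).getD o0
      (a, ostar) :: crawlAux rk fuel (agents.eraseIdx t) (objects.erase ostar)
    | _, _ => []

/-- Agents listed in increasing order of their endowments. -/
def ownersList {n : ℕ} (ω : Fin n → Fin n) : List (Fin n) :=
  (List.finRange n).filterMap fun o => (List.finRange n).find? fun a => ω a == o

/-- The (ascending) crawler allocation. -/
def CRfun {n : ℕ} (rk : Fin n → Fin n → Fin n) (ω : Fin n → Fin n) (i : Fin n) : Fin n :=
  ((crawlAux rk n (ownersList ω) (List.finRange n)).lookup i).getD (ω i)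

/-- The descending crawler: the mirror image of the ascending crawler, obtained by
reversing the order `≺` on objects. -/
def DCRfun {n : ℕ} (rk : Fin n → Fin n → Fin n) (ω : Fin n → Fin n) (i : Fin n) : Fin n :=
  Fin.rev (CRfun (fun j o => rk j o.rev) (fun j => (ω j).rev) i)

/-- Sequential priority: agents in the given list pick, in order, their most
preferred remaining object. -/
def SPAux {n : ℕ} (rk : Fin n → Fin n → Fin n) :
    List (Fin n) → List (Fin n) → List (Fin n × Fin n)
  | [], _ => []
  | _ :: _, [] => []
  | a :: as, o0 :: os =>
      let o := ((o0 :: os).argmin (rk a)).getD o0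
      (a, o) :: SPAux rk as ((o0 :: os).erase o)

/-- The sequential priority rule induced by the order `f` (agent `f k` has priority `k`). -/
def SPfun {n : ℕ} (rk : Fin n → Fin n → Fin n) (f : Fin n → Fin n) (i : Fin n) : Fin n :=
  ((SPAux rk ((List.finRange n).map f) (List.finRange n)).lookup i).getD i

/-- Top trading cycles: `own` maps each remaining object to its (initial) owner. -/
def TTCAux {n : ℕ} (rk : Fin n → Fin n → Fin n) :
    ℕ → List (Fin n) → List (Fin n) → (Fin n → Fin n) → List (Fin n × Fin n)
  | 0, _, _, _ => []
  | fuel + 1, agents, objects, own =>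
    match agents with
    | [] => []
    | a0 :: _ =>
      let top : Fin n → Fin n := fun a => (objects.argmin (rk a)).getD a0
      let ptr : Fin n → Fin n := fun a => own (top a)
      let onCyc : Fin n → Bool := fun a =>
        (List.range agents.length).any fun k => ptr^[k + 1] a == a
      let cyc := agents.filter onCyc
      let assigned := cyc.map top
      (cyc.map fun a => (a, top a)) ++
        TTCAux rk fuel (agents.filter fun a => !onCyc a)
          (objects.filter fun o => !(assigned.contains o)) own

/-- The top trading cycles allocation from endowments `ω`. -/
def TTCfun {n : ℕ} (rk : Fin n → Fin n → Fin n) (ω : Equiv.Perm (Fin n)) (i : Fin n) : Fin n :=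
  ((TTCAux rk n (List.finRange n) (List.finRange n) ω.symm).lookup i).getD (ω i)

/-- A profile of strict preferences (given as rank permutations) is single-peaked
with respect to the order on `Fin n`. -/
def SinglePeaked {n : ℕ} (P : Fin n → Equiv.Perm (Fin n)) : Prop :=
  ∀ i : Fin n, ∃ p : Fin n, ∀ o o' : Fin n,
    ((o' < o ∧ o ≤ p) ∨ (p ≤ o ∧ o < o')) → P i o < P i o'

/-- Pareto efficiency of an allocation `x` at the profile `P`. -/
def ParetoEfficient {n : ℕ} (P : Fin n → Equiv.Perm (Fin n)) (x : Fin n → Fin n) : Prop :=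
  ¬ ∃ y : Equiv.Perm (Fin n),
      (∀ i, P i (y i) ≤ P i (x i)) ∧ ∃ j, P j (y j) < P j (x j)

/-- The two properties of single-peaked preferences used below: ranks are injective, and
an object is better than at least one of any two objects lying on either side of it. -/
structure IsPeaked {n : ℕ} (rk : Fin n → Fin n → Fin n) : Prop where
  injective : ∀ i, Function.Injective (rk i)
  between : ∀ i p q r, p < q → q < r → rk i q < rk i p ∨ rk i q < rk i r

/-- The agent `i` at position `t` can be assigned the object `o` at position `a`: it is the
favourite remaining object of `i`, and every owner of an object in between strictly gains
from moving one position towards `t`. -/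
structure IsMove {n : ℕ} (rk : Fin n → Fin n → Fin n) (A O : List (Fin n)) (t a : ℕ)
    (i o : Fin n) : Prop where
  agent : A[t]? = some i
  object : O[a]? = some o
  top : ∀ p ∈ O, rk i o ≤ rk i p
  right : ∀ s j p q, a ≤ s → s < t → A[s]? = some j → O[s]? = some p → O[s + 1]? = some q →
    rk j q < rk j p
  left : ∀ s j p q, t ≤ s → s < a → A[s + 1]? = some j → O[s]? = some p → O[s + 1]? = some q →
    rk j p < rk j q

/-- `Run rk A O x`: some sequence of moves exhausts the state `(A, O)` and assigns to every
agent `i` in `A` the object `x i`. -/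
inductive Run {n : ℕ} (rk : Fin n → Fin n → Fin n) (x : Fin n → Fin n) :
    List (Fin n) → List (Fin n) → Prop
  | nil : Run rk x [] []
  | step {A O : List (Fin n)} {t a : ℕ} {i : Fin n} : IsMove rk A O t a i (x i) →
      Run rk x (A.eraseIdx t) (O.eraseIdx a) → Run rk x A O

/-- The position of the `j`-th entry of a list after the `k`-th one has been erased. -/
def shiftIdx (k j : ℕ) : ℕ := if j < k then j else j - 1

theorem eraseIdx_eraseIdx_shiftIdx {α : Type*} (l : List α) {j k : ℕ} (h : j ≠ k) :
    (l.eraseIdx k).eraseIdx (shiftIdx k j) = (l.eraseIdx j).eraseIdx (shiftIdx j k) := by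
  refine List.ext_getElem? fun s => ?_
  simp only [List.getElem?_eraseIdx, shiftIdx]
  grind

theorem getElem?_eraseIdx_shiftIdx {α : Type*} (l : List α) {j k : ℕ} (h : j ≠ k) :
    (l.eraseIdx k)[shiftIdx k j]? = l[j]? := by
  simp only [List.getElem?_eraseIdx, shiftIdx]
  grind

theorem reverse_eraseIdx_of_lt {α : Type*} (l : List α) {t : ℕ} (ht : t < l.length) :
    (l.eraseIdx t).reverse = l.reverse.eraseIdx (l.length - 1 - t) := by
  refine List.ext_getElem? fun s => ?_
  grind

section Moves

variable {n : ℕ} {rk : Fin n → Fin n → Fin n} {A O : List (Fin n)}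

theorem lt_of_getElem?_sorted (hO : O.Pairwise (· < ·)) {s s' : ℕ} {p q : Fin n}
    (hs : s < s') (hp : O[s]? = some p) (hq : O[s']? = some q) : p < q := by
  rw [List.getElem?_eq_some_iff] at hp hq
  obtain ⟨h₁, rfl⟩ := hp
  obtain ⟨h₂, rfl⟩ := hq
  exact List.pairwise_iff_getElem.1 hO _ _ h₁ h₂ hs

theorem rank_lt_of_top_le (hrk : IsPeaked rk) (hO : O.Pairwise (· < ·)) {i o p q : Fin n}
    {a s : ℕ} (ho : O[a]? = some o) (htop : ∀ p ∈ O, rk i o ≤ rk i p) (has : a ≤ s)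
    (hp : O[s]? = some p) (hq : O[s + 1]? = some q) : rk i p < rk i q := by
  have hpq := lt_of_getElem?_sorted hO s.lt_succ_self hp hq
  rcases has.eq_or_lt with rfl | has
  · obtain rfl : o = p := by simpa [ho] using hp
    exact lt_of_le_of_ne (htop _ (List.mem_of_getElem? hq)) fun e => hpq.ne (hrk.injective i e)
  · have hop := lt_of_getElem?_sorted hO has ho hp
    exact (hrk.between i _ _ _ hop hpq).resolve_left
      (not_lt.2 (htop _ (List.mem_of_getElem? hp)))

theorem rank_lt_of_lt_top (hrk : IsPeaked rk) (hO : O.Pairwise (· < ·)) {i o p q : Fin n}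
    {a s : ℕ} (ho : O[a]? = some o) (htop : ∀ p ∈ O, rk i o ≤ rk i p) (has : s < a)
    (hp : O[s]? = some p) (hq : O[s + 1]? = some q) : rk i q < rk i p := by
  have hpq := lt_of_getElem?_sorted hO s.lt_succ_self hp hq
  rcases (Nat.succ_le_of_lt has).eq_or_lt with rfl | has
  · obtain rfl : o = q := by simpa [ho] using hq
    exact lt_of_le_of_ne (htop _ (List.mem_of_getElem? hp)) fun e => hpq.ne' (hrk.injective i e)
  · have hqo := lt_of_getElem?_sorted hO has hq ho
    exact (hrk.between i _ _ _ hpq hqo).resolve_right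
      (not_lt.2 (htop _ (List.mem_of_getElem? hq)))

/-- Two moves concern disjoint intervals of positions, unless they are made by adjacent agents
crossing each other. -/
theorem IsMove.separated (hrk : IsPeaked rk) (hO : O.Pairwise (· < ·))
    (hlen : A.length = O.length) {t a t' a' : ℕ} {i o i' o' : Fin n}
    (h : IsMove rk A O t a i o) (h' : IsMove rk A O t' a' i' o') (htt : t < t') :
    (t < t' ∧ t < a' ∧ a < t' ∧ a < a') ∨ (t' = t + 1 ∧ a' ≤ t ∧ t' ≤ a) := by
  have ht' : t' < A.length := (List.getElem?_eq_some_iff.1 h'.agent).1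
  have ha : a < O.length := (List.getElem?_eq_some_iff.1 h.object).1
  have ex : ∀ s, s < O.length → ∃ p, O[s]? = some p := fun s hs =>
    ⟨O[s], List.getElem?_eq_getElem hs⟩
  have exA : ∀ s, s < O.length → ∃ p, A[s]? = some p := fun s hs =>
    ⟨A[s], List.getElem?_eq_getElem (hlen ▸ hs)⟩
  have left_stays : a ≤ t → t < a' := by
    intro hat
    by_contra! hat'
    obtain ⟨p, hp⟩ := ex t (by omega)
    obtain ⟨q, hq⟩ := ex (t + 1) (by omega)
    exact (rank_lt_of_top_le hrk hO h.object h.top hat hp hq).asymm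
      (h'.right t i p q hat' htt h.agent hp hq)
  have right_stays : t' ≤ a' → a < t' := by
    intro hat
    by_contra! hat'
    obtain ⟨s, rfl⟩ : ∃ s, t' = s + 1 := ⟨t' - 1, by omega⟩
    obtain ⟨p, hp⟩ := ex s (by omega)
    obtain ⟨q, hq⟩ := ex (s + 1) (by omega)
    exact (rank_lt_of_lt_top hrk hO h'.object h'.top (by omega) hp hq).asymm
      (h.left s i' p q (by omega) (by omega) h'.agent hp hq)
  by_contra! hcon
  have hat : t < a := by grind
  have hat' : a' < t' := by grind
  have haa : a' ≤ a := by grind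
  have htt' : t + 1 < t' := by grind
  obtain ⟨s, hs⟩ : ∃ s, s + 1 = max a' (t + 1) := ⟨max a' (t + 1) - 1, by omega⟩
  have hs' : s + 1 < t' := by omega
  obtain ⟨p, hp⟩ := ex s (by omega)
  obtain ⟨q, hq⟩ := ex (s + 1) (by omega)
  obtain ⟨r, hr⟩ := ex (s + 2) (by omega)
  obtain ⟨j, hj⟩ := exA (s + 1) (by omega)
  have h₁ := h.left s j p q (by omega) (by omega) hj hp hq
  have h₂ := h'.right (s + 1) j q r (by omega) hs' hj hq hr
  have := hrk.between j p q r (lt_of_getElem?_sorted hO s.lt_succ_self hp hq)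
    (lt_of_getElem?_sorted hO (s + 1).lt_succ_self hq hr)
  exact this.elim h₁.asymm h₂.asymm

/-- A move remains possible after a move by another agent. -/
theorem IsMove.eraseIdx (hrk : IsPeaked rk) (hO : O.Pairwise (· < ·))
    (hlen : A.length = O.length) {t a t' a' : ℕ} {i o i' o' : Fin n}
    (h : IsMove rk A O t a i o) (h' : IsMove rk A O t' a' i' o') (htt : t ≠ t') :
    a ≠ a' ∧ IsMove rk (A.eraseIdx t') (O.eraseIdx a') (shiftIdx t' t) (shiftIdx a' a) i o := by
  have key : a ≠ a' ∧ ((t < t' ∧ t < a' ∧ a < t' ∧ a < a') ∨ (t' = t + 1 ∧ a' ≤ t ∧ t' ≤ a) ∨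
      (t' < t ∧ t' < a ∧ a' < t ∧ a' < a) ∨ (t = t' + 1 ∧ a ≤ t' ∧ t ≤ a')) := by
    rcases htt.lt_or_gt with hlt | hlt
    · have := h.separated hrk hO hlen h' hlt; omega
    · have := h'.separated hrk hO hlen h hlt; omega
  obtain ⟨haa, key⟩ := key
  refine ⟨haa, ?_, ?_, fun p hp => h.top p (List.mem_of_mem_eraseIdx hp), ?_, ?_⟩
  · rw [getElem?_eraseIdx_shiftIdx _ htt, h.agent]
  · rw [getElem?_eraseIdx_shiftIdx _ haa, h.object]
  · intro s j p q h₁ h₂ hj hp hq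
    simp only [List.getElem?_eraseIdx, shiftIdx] at *
    have e₁ := h.right s j p q
    have e₂ := h.right (s + 1) j p q
    grind
  · intro s j p q h₁ h₂ hj hp hq
    simp only [List.getElem?_eraseIdx, shiftIdx] at *
    have e₁ := h.left s j p q
    have e₂ := h.left (s + 1) j p q
    grind

theorem IsMove.length_eraseIdx (hlen : A.length = O.length) {t a : ℕ} {i o : Fin n}
    (h : IsMove rk A O t a i o) : (A.eraseIdx t).length = (O.eraseIdx a).length := by
  rw [List.length_eraseIdx_of_lt (List.getElem?_eq_some_iff.1 h.agent).1,
    List.length_eraseIdx_of_lt (List.getElem?_eq_some_iff.1 h.object).1, hlen]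

/-- Any move can be performed first without changing the outcome. -/
theorem Run.of_isMove (hrk : IsPeaked rk) {x : Fin n → Fin n} (hx : Run rk x A O)
    (hO : O.Pairwise (· < ·)) (hlen : A.length = O.length) {t a : ℕ} {i o : Fin n}
    (h : IsMove rk A O t a i o) : x i = o ∧ Run rk x (A.eraseIdx t) (O.eraseIdx a) := by
  induction hx generalizing t a with
  | nil => simpa using h.agent
  | @step A O t' a' i' h' hx ih =>
    rcases eq_or_ne t t' with rfl | htt
    · obtain rfl : i = i' := by simpa [h.agent] using h'.agent
      obtain rfl : x i = o := hrk.injective i <| le_antisymm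
        (h'.top _ (List.mem_of_getElem? h.object)) (h.top _ (List.mem_of_getElem? h'.object))
      obtain rfl : a = a' := by
        rcases lt_trichotomy a a' with hlt | rfl | hlt
        · exact absurd (lt_of_getElem?_sorted hO hlt h.object h'.object) (lt_irrefl _)
        · rfl
        · exact absurd (lt_of_getElem?_sorted hO hlt h'.object h.object) (lt_irrefl _)
      exact ⟨rfl, hx⟩
    · obtain ⟨haa, hm⟩ := h.eraseIdx hrk hO hlen h' htt
      obtain ⟨hxi, hrun⟩ := ih (hO.sublist (List.eraseIdx_sublist _ _))
        (h'.length_eraseIdx hlen) hm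
      rw [eraseIdx_eraseIdx_shiftIdx _ htt, eraseIdx_eraseIdx_shiftIdx _ haa] at hrun
      exact ⟨hxi, .step (h'.eraseIdx hrk hO hlen h htt.symm).2 hrun⟩

/-- The outcome does not depend on the order of the moves. -/
theorem Run.unique (hrk : IsPeaked rk) {x y : Fin n → Fin n} (hx : Run rk x A O)
    (hy : Run rk y A O) (hO : O.Pairwise (· < ·)) (hlen : A.length = O.length)
    {i : Fin n} (hi : i ∈ A) : x i = y i := by
  induction hx with
  | nil => simp at hi
  | @step A O t a j h hx ih =>
    obtain ⟨hj, hy'⟩ := hy.of_isMove hrk hO hlen h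
    by_cases hij : i = j
    · rw [hij, hj]
    · refine ih hy' (hO.sublist (List.eraseIdx_sublist _ _)) (h.length_eraseIdx hlen) ?_
      obtain ⟨s, hs⟩ := List.mem_iff_getElem?.1 hi
      refine List.mem_eraseIdx_iff_getElem?.2 ⟨s, ?_, hs⟩
      rintro rfl
      exact hij (by simpa [h.agent] using hs.symm)

/-- The mirror image of a move is a move. -/
theorem IsMove.reverse (hlen : A.length = O.length) {t a : ℕ} {i o : Fin n}
    (h : IsMove (fun j p => rk j p.rev) A O t a i o) :
    IsMove rk A.reverse (O.map Fin.rev).reverse (A.length - 1 - t) (O.length - 1 - a) i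
      o.rev := by
  have ht : t < A.length := (List.getElem?_eq_some_iff.1 h.agent).1
  have ha : a < O.length := (List.getElem?_eq_some_iff.1 h.object).1
  have hA : ∀ s j, A.reverse[s]? = some j → s < A.length ∧ A[A.length - 1 - s]? = some j := by
    intro s j hs
    have hlt : s < A.length := by simpa using (List.getElem?_eq_some_iff.1 hs).1
    exact ⟨hlt, by rwa [List.getElem?_reverse hlt] at hs⟩
  have hO : ∀ s p, (O.map Fin.rev).reverse[s]? = some p →
      s < O.length ∧ O[O.length - 1 - s]? = some p.rev := by
    intro s p hs
    have hlt : s < O.length := by simpa using (List.getElem?_eq_some_iff.1 hs).1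
    rw [List.getElem?_reverse (by simpa using hlt)] at hs
    simp only [List.length_map, List.getElem?_map, Option.map_eq_some_iff] at hs
    obtain ⟨q, hq, rfl⟩ := hs
    exact ⟨hlt, by rw [hq, Fin.rev_rev]⟩
  refine ⟨?_, ?_, ?_, ?_, ?_⟩
  · rw [List.getElem?_reverse (by omega), ← h.agent]
    congr 1; omega
  · rw [List.getElem?_reverse (by simp; omega), List.getElem?_map, List.length_map,
      show O.length - 1 - (O.length - 1 - a) = a by omega, h.object]
    rfl
  · intro p hp
    simp only [List.mem_reverse, List.mem_map] at hp
    obtain ⟨q, hq, rfl⟩ := hp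
    exact h.top q hq
  · intro s j p q h₁ h₂ hj hp hq
    obtain ⟨_, hj⟩ := hA s j hj
    obtain ⟨_, hp⟩ := hO s p hp
    obtain ⟨_, hq⟩ := hO (s + 1) q hq
    have e : O.length - 1 - s = O.length - 1 - (s + 1) + 1 := by omega
    rw [hlen, e] at hj
    rw [e] at hp
    simpa using h.left _ j q.rev p.rev (by omega) (by omega) hj hq hp
  · intro s j p q h₁ h₂ hj hp hq
    obtain ⟨_, hj⟩ := hA (s + 1) j hj
    obtain ⟨_, hp⟩ := hO s p hp
    obtain ⟨_, hq⟩ := hO (s + 1) q hq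
    have e : O.length - 1 - s = O.length - 1 - (s + 1) + 1 := by omega
    rw [hlen] at hj
    rw [e] at hp
    simpa using h.right _ j q.rev p.rev (by omega) (by omega) hj hq hp

theorem Run.reverse {x : Fin n → Fin n} (hx : Run (fun j p => rk j p.rev) x A O)
    (hlen : A.length = O.length) :
    Run rk (fun i => (x i).rev) A.reverse (O.map Fin.rev).reverse := by
  induction hx with
  | nil => exact .nil
  | @step A O t a i h hx ih =>
    refine .step (h.reverse hlen) ?_
    have := ih (h.length_eraseIdx hlen)
    rw [reverse_eraseIdx_of_lt _ (List.getElem?_eq_some_iff.1 h.agent).1,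
      ← List.eraseIdx_map, reverse_eraseIdx_of_lt _ (by
        simpa using (List.getElem?_eq_some_iff.1 h.object).1), List.length_map] at this
    exact this

end Moves

section Crawler

variable {n : ℕ} {rk : Fin n → Fin n → Fin n}

theorem findIdx2_lt {A O : List (Fin n)} (hA : A ≠ []) (hlen : A.length = O.length) :
    findIdx2 rk A O < A.length := by
  fun_induction findIdx2 rk A O <;> grind

theorem rank_le_of_lt_findIdx2 {A O : List (Fin n)} {s : ℕ} {j p q : Fin n}
    (hs : s < findIdx2 rk A O) (hj : A[s]? = some j) (hp : O[s]? = some p)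
    (hq : O[s + 1]? = some q) : rk j q ≤ rk j p := by
  fun_induction findIdx2 rk A O generalizing s <;> cases s <;> grind

theorem rank_lt_at_findIdx2 {A O : List (Fin n)} (hlen : A.length = O.length) {j p q : Fin n}
    (hj : A[findIdx2 rk A O]? = some j) (hp : O[findIdx2 rk A O]? = some p)
    (hq : O[findIdx2 rk A O + 1]? = some q) : rk j p < rk j q := by
  fun_induction findIdx2 rk A O with
  | case1 => grind
  | case2 => grind
  | case3 A O h =>
    obtain _ | ⟨a, A⟩ := A
    · simp at hj
    obtain _ | ⟨o₁, _ | ⟨o₂, O⟩⟩ := O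
    · simp at hp
    · simp at hq
    · exact (h a A o₁ o₂ O rfl rfl).elim

theorem crawlAux_succ {A O : List (Fin n)} {o : Fin n} (m : ℕ) (ht : findIdx2 rk A O < A.length)
    (ho : O.argmin (rk A[findIdx2 rk A O]) = some o) :
    crawlAux rk (m + 1) A O = (A[findIdx2 rk A O], o) ::
      crawlAux rk m (A.eraseIdx (findIdx2 rk A O)) (O.erase o) := by
  obtain _ | ⟨a₀, A⟩ := A
  · simp at ht
  obtain _ | ⟨o₀, O⟩ := O
  · simp at ho
  rw [crawlAux]
  simp only [List.getD_eq_getElem _ _ ht, ho, Option.getD_some]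

/-- Each step of the crawler is a move. -/
theorem isMove_findIdx2 (hrk : IsPeaked rk) {A O : List (Fin n)} (hO : O.Pairwise (· < ·))
    (hlen : A.length = O.length) {i o : Fin n} {a : ℕ} (hi : A[findIdx2 rk A O]? = some i)
    (ho : O[a]? = some o) (htop : ∀ p ∈ O, rk i o ≤ rk i p) :
    IsMove rk A O (findIdx2 rk A O) a i o := by
  have hle : a ≤ findIdx2 rk A O := by
    by_contra! hlt
    have ha : a < O.length := (List.getElem?_eq_some_iff.1 ho).1
    have hp := List.getElem?_eq_getElem (hlt.trans ha)
    have hq := List.getElem?_eq_getElem (show findIdx2 rk A O + 1 < O.length by omega)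
    exact (rank_lt_at_findIdx2 hlen hi hp hq).asymm
      (rank_lt_of_lt_top hrk hO ho htop hlt hp hq)
  refine ⟨hi, ho, htop, fun s j p q _ hs hj hp hq => ?_, fun s _ _ _ _ _ => by omega⟩
  exact lt_of_le_of_ne (rank_le_of_lt_findIdx2 hs hj hp hq) fun e =>
    (lt_of_getElem?_sorted hO s.lt_succ_self hp hq).ne' (hrk.injective j e)

theorem run_crawlAux (hrk : IsPeaked rk) (d : Fin n → Fin n) {A O : List (Fin n)}
    (hA : A.Nodup) (hO : O.Pairwise (· < ·)) (hlen : A.length = O.length) {m : ℕ}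
    (hm : A.length = m) {x : Fin n → Fin n}
    (hx : ∀ j ∈ A, x j = ((crawlAux rk m A O).lookup j).getD (d j)) : Run rk x A O := by
  induction m generalizing A O with
  | zero =>
    obtain rfl := List.length_eq_zero_iff.1 hm
    obtain rfl := List.length_eq_zero_iff.1 hlen.symm
    exact .nil
  | succ m ih =>
    have ht : findIdx2 rk A O < A.length := findIdx2_lt (List.ne_nil_of_length_eq_add_one hm) hlen
    obtain ⟨o, ho⟩ : ∃ o, O.argmin (rk A[findIdx2 rk A O]) = some o := by
      rw [← Option.ne_none_iff_exists', ne_eq, List.argmin_eq_none]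
      exact List.ne_nil_of_length_eq_add_one (hlen ▸ hm)
    have hcr := crawlAux_succ m ht ho
    set i := A[findIdx2 rk A O]
    have hmem : o ∈ O := List.argmin_mem ho
    have hidx : O[O.idxOf o]? = some o := by grind
    have hmove := isMove_findIdx2 hrk hO hlen (List.getElem?_eq_getElem ht) hidx
      fun p hp => List.le_of_mem_argmin hp ho
    have hxi : x i = o := by
      rw [hx i (List.getElem_mem ht), hcr]
      simp
    rw [← hxi] at hmove
    refine .step hmove (ih (hA.sublist (List.eraseIdx_sublist _ _))
      (hO.sublist (List.eraseIdx_sublist _ _)) (hmove.length_eraseIdx hlen)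
      (by rw [List.length_eraseIdx_of_lt ht]; omega) fun j hj => ?_)
    have hji : j ≠ i := by
      obtain ⟨s, hs, hsj⟩ := List.mem_eraseIdx_iff_getElem?.1 hj
      rintro rfl
      exact hs (((List.getElem?_inj ht hA).1 ((List.getElem?_eq_getElem ht).trans hsj.symm)).symm)
    rw [hx j (List.mem_of_mem_eraseIdx hj), hcr, hxi,
      List.erase_eq_eraseIdx_of_idxOf rfl]
    simp [List.lookup_cons, beq_false_of_ne hji]

theorem ownersList_perm (ω : Equiv.Perm (Fin n)) :
    ownersList ω = (List.finRange n).map ω.symm := by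
  rw [ownersList, ← List.filterMap_eq_map]
  refine List.filterMap_congr fun o _ => ?_
  have : ∀ a ∈ List.finRange n, (ω a == o) = (a == ω.symm o) := by
    intro a _
    rw [Bool.eq_iff_iff]
    simp [Equiv.eq_symm_apply]
  rw [List.find?_congr this, Function.comp_apply, List.find?_eq_some_iff_getElem]
  refine ⟨by simp, ω.symm o, by simp, by simp, fun j hj => ?_⟩
  simpa [Fin.ext_iff] using hj.ne

theorem run_CRfun (hrk : IsPeaked rk) (ω : Equiv.Perm (Fin n)) :
    Run rk (CRfun rk ω) (ownersList ω) (List.finRange n) :=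
  run_crawlAux hrk ω
    (by rw [ownersList_perm]; exact (List.nodup_finRange n).map ω.symm.injective)
    (List.pairwise_lt_finRange n) (by simp [ownersList_perm]) (by simp [ownersList_perm])
    fun _ _ => rfl

theorem SinglePeaked.isPeaked {P : Fin n → Equiv.Perm (Fin n)} (hP : SinglePeaked P) :
    IsPeaked fun j => ⇑(P j) where
  injective i := (P i).injective
  between i p q r hpq hqr := by
    obtain ⟨c, hc⟩ := hP i
    rcases le_total q c with h | h
    · exact .inl (hc q p (.inl ⟨hpq, h⟩))
    · exact .inr (hc q r (.inr ⟨h, hqr⟩))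

theorem IsPeaked.rev (hrk : IsPeaked rk) : IsPeaked fun j o => rk j o.rev where
  injective i := (hrk.injective i).comp Fin.rev_injective
  between i p q r hpq hqr :=
    (hrk.between i r.rev q.rev p.rev (Fin.rev_lt_rev.2 hqr) (Fin.rev_lt_rev.2 hpq)).symm

theorem run_DCRfun (hrk : IsPeaked rk) (ω : Equiv.Perm (Fin n)) :
    Run rk (DCRfun rk ω) (ownersList ω) (List.finRange n) := by
  have h := (run_CRfun hrk.rev (ω.trans Fin.revPerm)).reverse (by rw [ownersList_perm]; simp)
  have hA : (ownersList (ω.trans Fin.revPerm)).reverse = ownersList ω := by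
    rw [ownersList_perm, ownersList_perm, ← List.map_reverse, List.finRange_reverse,
      List.map_map]
    refine List.map_congr_left fun o _ => ?_
    simp
  have hO : ((List.finRange n).map Fin.rev).reverse = List.finRange n := by
    rw [← List.finRange_reverse, List.reverse_reverse]
  rw [hA, hO] at h
  exact h

end Crawler

/-- if `ω_i ≺ ACR_i(P,ω)` then `ACR_i(P,ω) = DCR_i(P,ω)`. -/
theorem acr_eq_dcr_of_endowment_lt {n : ℕ} (hn : 1 ≤ n)
    (P : Fin n → Equiv.Perm (Fin n)) (hP : SinglePeaked P) (ω : Equiv.Perm (Fin n))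
    (i : Fin n) (h : ω i < CRfun (fun j => ⇑(P j)) ⇑ω i) :
    CRfun (fun j => ⇑(P j)) ⇑ω i = DCRfun (fun j => ⇑(P j)) ⇑ω i := by
  have hrk := hP.isPeaked
  exact (run_CRfun hrk ω).unique hrk (run_DCRfun hrk ω) (List.pairwise_lt_finRange n)
    (by simp [ownersList_perm]) (by simp [ownersList_perm, Equiv.symm_apply_eq])
end

section
/- For every preference profile P that is single-peaked with respect to ≺, the crawler from random endowments equals the random priority rule: for every allocation x, the number of endowment profiles ω with CR(P,ω) = x equals the number of orders f on N with SP^f(P) = x; equivalently, drawing ω uniformly among the n! endowment profiles and applying the crawler induces the same probability distribution over allocations as drawing f uniformly among the n! orders and applying SP^f. -/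
/-! ### Favourite remaining objects and their ranks -/

/-- The favourite object of agent `a` among the remaining objects `O`. -/
def topObj {n : ℕ} (P : Fin n → Equiv.Perm (Fin n)) (a : Fin n) (O : Finset (Fin n)) : Fin n :=
  (O.sort.argmin (P a)).getD a

/-- The position (from zero) of agent `a`'s favourite object among the remaining objects `O`. -/
def topRank {n : ℕ} (P : Fin n → Equiv.Perm (Fin n)) (a : Fin n) (O : Finset (Fin n)) : ℕ :=
  (O.filter (· < topObj P a O)).card

section Favourite

variable {n : ℕ} {P : Fin n → Equiv.Perm (Fin n)} {O : Finset (Fin n)}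

theorem topObj_spec (P : Fin n → Equiv.Perm (Fin n)) (a : Fin n) (hO : O.Nonempty) :
    topObj P a O ∈ O ∧ ∀ o ∈ O, P a (topObj P a O) ≤ P a o := by
  obtain ⟨m, hm⟩ : ∃ m, (O.sort (· ≤ ·)).argmin (P a) = some m := by
    rw [← Option.ne_none_iff_exists', Ne, List.argmin_eq_none]
    intro h
    obtain ⟨o, ho⟩ := hO
    simpa [h] using (Finset.mem_sort (· ≤ ·)).2 ho
  have hm' : topObj P a O = m := by simp [topObj, hm]
  rw [hm']
  exact ⟨(Finset.mem_sort (· ≤ ·)).1 (List.argmin_mem hm),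
    fun o ho => List.le_of_mem_argmin ((Finset.mem_sort (· ≤ ·)).2 ho) hm⟩

theorem topObj_mem (P : Fin n → Equiv.Perm (Fin n)) (a : Fin n) (hO : O.Nonempty) :
    topObj P a O ∈ O :=
  (topObj_spec P a hO).1

theorem topObj_eq {a o : Fin n} (ho : o ∈ O) (h : ∀ o' ∈ O, P a o ≤ P a o') :
    topObj P a O = o :=
  have hs := topObj_spec P a ⟨o, ho⟩
  (P a).injective (le_antisymm (hs.2 o ho) (h _ hs.1))

theorem topRank_lt_card (P : Fin n → Equiv.Perm (Fin n)) (a : Fin n) (hO : O.Nonempty) :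
    topRank P a O < O.card := by
  apply Finset.card_lt_card
  rw [Finset.filter_ssubset]
  exact ⟨_, topObj_mem P a hO, lt_irrefl _⟩

theorem topRank_lt_of_topObj_lt {a b : Fin n} (hO : O.Nonempty)
    (h : topObj P a O < topObj P b O) : topRank P a O < topRank P b O := by
  apply Finset.card_lt_card
  refine (Finset.ssubset_iff_of_subset ?_).2 ⟨topObj P a O, ?_, ?_⟩
  · exact Finset.monotone_filter_right _ fun o _ ho => lt_trans ho h
  · simpa using ⟨topObj_mem P a hO, h⟩
  · simp

theorem topObj_lt_iff {a b : Fin n} (hO : O.Nonempty) :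
    topObj P a O < topObj P b O ↔ topRank P a O < topRank P b O := by
  refine ⟨topRank_lt_of_topObj_lt hO, fun h => ?_⟩
  by_contra! h'
  rcases h'.lt_or_eq with h' | h'
  · exact absurd (topRank_lt_of_topObj_lt hO h') (by omega)
  · simp [topRank, h'] at h

theorem topObj_erase_of_ne {a o : Fin n} (hO : O.Nonempty) (h : topObj P a O ≠ o) :
    topObj P a (O.erase o) = topObj P a O :=
  topObj_eq (Finset.mem_erase.2 ⟨h, topObj_mem P a hO⟩)
    fun o' ho' => (topObj_spec P a hO).2 o' (Finset.mem_of_mem_erase ho')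

theorem topObj_erase_of_topRank_ne {a b : Fin n} (hO : O.Nonempty)
    (h : topRank P a O ≠ topRank P b O) :
    topObj P a (O.erase (topObj P b O)) = topObj P a O :=
  topObj_erase_of_ne hO fun h' => h (by simp [topRank, h'])

theorem topRank_erase_of_lt {a b : Fin n} (hO : O.Nonempty)
    (h : topRank P a O < topRank P b O) :
    topRank P a (O.erase (topObj P b O)) = topRank P a O := by
  have hlt := (topObj_lt_iff hO).2 h
  rw [topRank, topObj_erase_of_topRank_ne hO h.ne, Finset.filter_erase,
    Finset.erase_eq_of_notMem (by simp [hlt.le]), topRank]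

theorem topRank_erase_of_gt {a b : Fin n} (hO : O.Nonempty)
    (h : topRank P b O < topRank P a O) :
    topRank P a (O.erase (topObj P b O)) = topRank P a O - 1 := by
  have hlt := (topObj_lt_iff hO).2 h
  rw [topRank, topObj_erase_of_topRank_ne hO h.ne', Finset.filter_erase,
    Finset.card_erase_of_mem (by simpa using ⟨topObj_mem P b hO, hlt⟩), topRank]

/-- When the favourite object of an agent with single-peaked preferences is removed, the new
favourite object is one of its two neighbours. -/
theorem topRank_erase_topObj_self (hP : SinglePeaked P) (a : Fin n) :
    topRank P a (O.erase (topObj P a O)) ≤ topRank P a O ∧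
      topRank P a O ≤ topRank P a (O.erase (topObj P a O)) + 1 := by
  rcases (O.erase (topObj P a O)).eq_empty_or_nonempty with hE | hE
  · have h1 : topRank P a O ≤ 0 := by
      rw [topRank, Nat.le_zero, Finset.card_eq_zero, Finset.filter_eq_empty_iff]
      intro o ho hlt
      have : o ∈ O.erase (topObj P a O) := Finset.mem_erase.2 ⟨hlt.ne, ho⟩
      simp [hE] at this
    have h2 : topRank P a (O.erase (topObj P a O)) = 0 := by simp [topRank, hE]
    omega
  have hO : O.Nonempty := hE.mono (Finset.erase_subset _ _)
  obtain ⟨hm, hmin⟩ := topObj_spec P a hO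
  obtain ⟨hm', hmin'⟩ := topObj_spec P a hE
  obtain ⟨p, hp⟩ := hP a
  unfold topRank
  set o := topObj P a O
  set q := topObj P a (O.erase o)
  obtain ⟨hqo, hqO⟩ := Finset.mem_erase.1 hm'
  have between : ∀ z ∈ O, ¬ (q < z ∧ z < o) ∧ ¬ (o < z ∧ z < q) := by
    refine fun z hz => ⟨fun ⟨h1, h2⟩ => ?_, fun ⟨h1, h2⟩ => ?_⟩
    · have hzE := hmin' z (Finset.mem_erase.2 ⟨h2.ne, hz⟩)
      have hzO := hmin z hz
      rcases le_total z p with h | h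
      · exact absurd (hp z q (Or.inl ⟨h1, h⟩)) (not_lt.2 hzE)
      · exact absurd (hp z o (Or.inr ⟨h, h2⟩)) (not_lt.2 hzO)
    · have hzE := hmin' z (Finset.mem_erase.2 ⟨h1.ne', hz⟩)
      have hzO := hmin z hz
      rcases le_total z p with h | h
      · exact absurd (hp z o (Or.inl ⟨h1, h⟩)) (not_lt.2 hzO)
      · exact absurd (hp z q (Or.inr ⟨h, h2⟩)) (not_lt.2 hzE)
  constructor
  · refine Finset.card_le_card fun z hz => ?_
    simp only [Finset.mem_filter, Finset.mem_erase] at hz ⊢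
    exact ⟨hz.1.2, lt_of_le_of_ne (not_lt.1 fun h => (between z hz.1.2).2 ⟨h, hz.2⟩) hz.1.1⟩
  · refine (Finset.card_le_card (t := insert q ((O.erase o).filter (· < q))) fun z hz => ?_).trans
      (Finset.card_insert_le _ _)
    simp only [Finset.mem_filter, Finset.mem_erase, Finset.mem_insert] at hz ⊢
    rcases lt_trichotomy z q with h | h | h
    · exact Or.inr ⟨⟨hz.2.ne, hz.1⟩, h⟩
    · exact Or.inl h
    · exact absurd ⟨h, hz.2⟩ (between z hz.1).1

theorem topRank_erase_of_eq (hP : SinglePeaked P) {a b : Fin n} (hO : O.Nonempty)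
    (h : topRank P a O = topRank P b O) :
    topRank P a (O.erase (topObj P b O)) ≤ topRank P a O ∧
      topRank P a O ≤ topRank P a (O.erase (topObj P b O)) + 1 := by
  have : topObj P b O = topObj P a O := by
    rcases lt_trichotomy (topObj P b O) (topObj P a O) with h' | h' | h'
    · exact absurd ((topObj_lt_iff hO).1 h') (by omega)
    · exact h'
    · exact absurd ((topObj_lt_iff hO).1 h') (by omega)
  rw [this]
  exact topRank_erase_topObj_self hP a

theorem card_erase_topObj {m : ℕ} (P : Fin n → Equiv.Perm (Fin n)) (a : Fin n)
    (hO : O.card = m + 1) : (O.erase (topObj P a O)).card = m := by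
  rw [Finset.card_erase_of_mem (topObj_mem P a (Finset.card_pos.1 (by omega))), hO]
  rfl

end Favourite

/-! ### Counting orders -/

open Classical in
/-- The number of orders of the agents in `A` that have property `Q`. -/
noncomputable def orderCount {α : Type*} (A : Finset α) (Q : List α → Prop) : ℕ :=
  (A.val.lists.toFinset.filter Q).card

section OrderCount

variable {α : Type*} {A : Finset α} {Q Q' : List α → Prop}

theorem orderCount_congr (h : ∀ σ : List α, (σ : Multiset α) = A.val → (Q σ ↔ Q' σ)) :
    orderCount A Q = orderCount A Q' := by
  classical
  unfold orderCount
  congr 1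
  exact Finset.filter_congr fun σ hσ =>
    h σ ((Multiset.mem_lists_iff _ _).1 (Multiset.mem_toFinset.1 hσ)).symm

theorem orderCount_congr_of_length (h : ∀ σ : List α, σ.length = A.card → (Q σ ↔ Q' σ)) :
    orderCount A Q = orderCount A Q' :=
  orderCount_congr fun σ hσ => h σ (by simpa using congrArg Multiset.card hσ)

theorem orderCount_eq_add (A : Finset α) (Q R : List α → Prop) :
    orderCount A Q =
      orderCount A (fun σ => Q σ ∧ R σ) + orderCount A (fun σ => Q σ ∧ ¬ R σ) := by
  classical
  unfold orderCount
  rw [← Finset.card_filter_add_card_filter_not (s := A.val.lists.toFinset.filter Q) R,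
    Finset.filter_filter, Finset.filter_filter]
  congr!

/-- An order of `A` amounts to the agent at position `k` and an order of the others. -/
theorem orderCount_eraseIdx [DecidableEq α] {k : ℕ} (hk : k < A.card)
    (R : α → List α → Prop) :
    orderCount A (fun σ => ∃ b, σ[k]? = some b ∧ R b (σ.eraseIdx k)) =
      ∑ b ∈ A, orderCount (A.erase b) (R b) := by
  classical
  unfold orderCount
  rw [← Finset.card_sigma]
  symm
  refine Finset.card_bij (fun p _ => p.2.insertIdx k p.1) ?_ ?_ ?_
  · rintro ⟨b, τ⟩ hp
    simp only [Finset.mem_sigma, Finset.mem_filter, Multiset.mem_toFinset,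
      Multiset.mem_lists_iff] at hp ⊢
    obtain ⟨hb, hτ, hR⟩ := hp
    have hlen : τ.length = A.card - 1 := by
      have := congrArg Multiset.card hτ
      rw [Finset.card_val, Finset.card_erase_of_mem hb] at this
      exact this.symm
    have hkl : k ≤ τ.length := by omega
    refine ⟨?_, b, by simp [List.getElem?_insertIdx_self, hkl], by simpa using hR⟩
    have h1 : ((τ.insertIdx k b : List α) : Multiset α) = ((b :: τ : List α) : Multiset α) :=
      Multiset.coe_eq_coe.2 (List.perm_insertIdx b τ hkl)
    change A.val = ((τ.insertIdx k b : List α) : Multiset α)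
    change (A.erase b).val = (τ : Multiset α) at hτ
    rw [h1, ← Multiset.cons_coe, ← hτ, Finset.erase_val, Multiset.cons_erase hb]
  · rintro ⟨b, τ⟩ hp ⟨b', τ'⟩ hp' h
    simp only [Finset.mem_sigma, Finset.mem_filter, Multiset.mem_toFinset,
      Multiset.mem_lists_iff] at hp hp'
    have hlen : τ.length = A.card - 1 := by
      have := congrArg Multiset.card hp.2.1
      rw [Finset.card_val, Finset.card_erase_of_mem hp.1] at this
      exact this.symm
    have hlen' : τ'.length = A.card - 1 := by
      have := congrArg Multiset.card hp'.2.1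
      rw [Finset.card_val, Finset.card_erase_of_mem hp'.1] at this
      exact this.symm
    simp only at h
    have h1 : (τ.insertIdx k b)[k]? = (τ'.insertIdx k b')[k]? := by rw [h]
    have h2 : (τ.insertIdx k b).eraseIdx k = (τ'.insertIdx k b').eraseIdx k := by rw [h]
    rw [List.getElem?_insertIdx_self, List.getElem?_insertIdx_self, if_pos (by omega),
      if_pos (by omega)] at h1
    simp only [List.eraseIdx_insertIdx_self] at h2
    cases h1
    cases h2
    rfl
  · intro σ hσ
    simp only [Finset.mem_filter, Multiset.mem_toFinset, Multiset.mem_lists_iff] at hσ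
    obtain ⟨hA, b, hb, hR⟩ := hσ
    change A.val = (σ : Multiset α) at hA
    obtain ⟨hkl, rfl⟩ := List.getElem?_eq_some_iff.1 hb
    have hmem : σ[k] ∈ A := by
      rw [← Finset.mem_val, hA]
      simp
    refine ⟨⟨σ[k], σ.eraseIdx k⟩, ?_, List.insertIdx_eraseIdx_getElem hkl⟩
    simp only [Finset.mem_sigma, Finset.mem_filter, Multiset.mem_toFinset, Multiset.mem_lists_iff]
    refine ⟨hmem, ?_, hR⟩
    change (A.erase σ[k]).val = ((σ.eraseIdx k : List α) : Multiset α)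
    rw [Finset.erase_val, hA]
    rw [Multiset.coe_erase, Multiset.coe_eq_coe]
    exact List.erase_getElem hkl

end OrderCount

/-! ### The crawler as a relation on orders of the agents -/

/-- The agent at each position `i < t` of the order `σ` satisfies `S i`. -/
def PrefixAll {α : Type*} (S : ℕ → α → Prop) (t : ℕ) (σ : List α) : Prop :=
  ∀ i < t, ∀ a, σ[i]? = some a → S i a

/-- The agents at the first `t` positions of the order `σ` all have their favourite remaining
object strictly to the right of the one they own. -/
def Waiting {n : ℕ} (P : Fin n → Equiv.Perm (Fin n)) (O : Finset (Fin n)) (t : ℕ)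
    (σ : List (Fin n)) : Prop :=
  PrefixAll (fun i a => i < topRank P a O) t σ

/-- The crawler assigns the agents in `σ`, who own the objects `O` in this order,
according to `x`. -/
inductive CrawlsTo {n : ℕ} (P : Fin n → Equiv.Perm (Fin n)) (x : Fin n → Fin n) :
    List (Fin n) → Finset (Fin n) → Prop
  | nil (O : Finset (Fin n)) : CrawlsTo P x [] O
  | step {σ : List (Fin n)} {O : Finset (Fin n)} {k : ℕ} {b : Fin n} (hb : σ[k]? = some b)
      (hw : Waiting P O k σ) (hk : topRank P b O ≤ k) (hx : topObj P b O = x b)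
      (h : CrawlsTo P x (σ.eraseIdx k) (O.erase (topObj P b O))) : CrawlsTo P x σ O

/-- If the agent at position `j` of `σ` first takes her favourite object, which is the one
assigned by `x`, then the crawler assigns the other agents according to `x`. -/
def PicksAt {n : ℕ} (P : Fin n → Equiv.Perm (Fin n)) (x : Fin n → Fin n) (j : ℕ)
    (σ : List (Fin n)) (O : Finset (Fin n)) : Prop :=
  ∃ b, σ[j]? = some b ∧ topObj P b O = x b ∧
    CrawlsTo P x (σ.eraseIdx j) (O.erase (topObj P b O))

section Positions

variable {α : Type*} {S : ℕ → α → Prop} {σ : List α} {t k : ℕ}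

theorem PrefixAll.mono (h : PrefixAll S t σ) (hk : k ≤ t) : PrefixAll S k σ :=
  fun i hi => h i (hi.trans_le hk)

theorem prefixAll_succ_iff {b : α} (hb : σ[t]? = some b) :
    PrefixAll S (t + 1) σ ↔ PrefixAll S t σ ∧ S t b := by
  refine ⟨fun h => ⟨h.mono t.le_succ, h t t.lt_succ_self b hb⟩, fun ⟨h, h'⟩ i hi a ha => ?_⟩
  rcases Nat.lt_succ_iff_lt_or_eq.1 hi with hi | rfl
  · exact h i hi a ha
  · rw [hb, Option.some_inj] at ha
    exact ha ▸ h'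

theorem prefixAll_eraseIdx_iff (h : t ≤ k) : PrefixAll S t (σ.eraseIdx k) ↔ PrefixAll S t σ := by
  refine forall₂_congr fun i hi => ?_
  rw [List.getElem?_eraseIdx, if_pos (hi.trans_le h)]

theorem prefixAll_succ_iff_eraseIdx {b : α} (hb : σ[k]? = some b) (hk : k ≤ t) :
    PrefixAll S (t + 1) σ ↔
      S k b ∧ PrefixAll (fun i => if i < k then S i else S (i + 1)) t (σ.eraseIdx k) := by
  constructor
  · refine fun h => ⟨h k (by omega) b hb, fun i hi a ha => ?_⟩
    rw [List.getElem?_eraseIdx] at ha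
    split_ifs at ha ⊢
    · exact h i (by omega) a ha
    · exact h (i + 1) (by omega) a ha
  · rintro ⟨hSb, h⟩ i hi a ha
    rcases lt_trichotomy i k with hik | rfl | hik
    · have := h i (by omega) a (by rw [List.getElem?_eraseIdx, if_pos hik, ha])
      simpa [hik] using this
    · rw [hb, Option.some_inj] at ha
      exact ha ▸ hSb
    · obtain ⟨i, rfl⟩ : ∃ i', i = i' + 1 := ⟨i - 1, by omega⟩
      have hik' : ¬ i < k := by omega
      have := h i (by omega) a (by rw [List.getElem?_eraseIdx, if_neg hik', ha])
      simpa [hik'] using this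

theorem eraseIdx_eraseIdx_of_lt {i j : ℕ} (σ : List α) (h : i < j) :
    (σ.eraseIdx j).eraseIdx i = (σ.eraseIdx i).eraseIdx (j - 1) := by
  apply List.ext_getElem?
  intro l
  simp only [List.getElem?_eraseIdx]
  split_ifs <;> first | rfl | omega

end Positions

section Crawl

variable {n : ℕ} {P : Fin n → Equiv.Perm (Fin n)} {x : Fin n → Fin n} {σ : List (Fin n)}
  {O : Finset (Fin n)}

theorem crawlsTo_iff {k : ℕ} {b : Fin n} (hb : σ[k]? = some b) (hw : Waiting P O k σ)
    (hk : topRank P b O ≤ k) :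
    CrawlsTo P x σ O ↔
      topObj P b O = x b ∧ CrawlsTo P x (σ.eraseIdx k) (O.erase (topObj P b O)) := by
  refine ⟨fun h => ?_, fun h => .step hb hw hk h.1 h.2⟩
  cases h with
  | nil => simp at hb
  | @step _ _ k' b' hb' hw' hk' hx h =>
    obtain rfl : k = k' := by
      rcases lt_trichotomy k k' with h' | h' | h'
      · exact absurd (hw' k h' b hb) (by omega)
      · exact h'
      · exact absurd (hw k' h' b' hb') (by omega)
    obtain rfl : b = b' := by simpa [hb] using hb'
    exact ⟨hx, h⟩

theorem crawlsTo_iff_picksAt {k : ℕ} {b : Fin n} (hb : σ[k]? = some b) (hw : Waiting P O k σ)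
    (hk : topRank P b O ≤ k) : CrawlsTo P x σ O ↔ PicksAt P x k σ O := by
  rw [crawlsTo_iff hb hw hk]
  simp [PicksAt, hb]

/-- Removing an object at or beyond the position of a waiting agent keeps her waiting, as long
as she is not next to it. -/
theorem lt_topRank_erase (hP : SinglePeaked P) (hO : O.Nonempty) {a c : Fin n} {i : ℕ}
    (hi : i + 1 < topRank P a O) (hc : i < topRank P c O) :
    i < topRank P c (O.erase (topObj P a O)) := by
  rcases lt_trichotomy (topRank P c O) (topRank P a O) with h | h | h
  · rwa [topRank_erase_of_lt hO h]
  · have := (topRank_erase_of_eq hP hO h).2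
    omega
  · rw [topRank_erase_of_gt hO h]
    omega

/-- The first agent to move in the crawler, at position `k`, and an agent at a later position
who wants an object further to the right can move in either order. -/
theorem picksAt_iff_of_lt (hP : SinglePeaked P) (hO : O.Nonempty) {k j : ℕ} {a b : Fin n}
    (hkj : k < j) (ha : σ[j]? = some a) (hb : σ[k]? = some b) (hw : Waiting P O k σ)
    (hbk : topRank P b O ≤ k) (hak : k < topRank P a O) :
    PicksAt P x j σ O ↔
      topObj P b O = x b ∧ PicksAt P x (j - 1) (σ.eraseIdx k) (O.erase (topObj P b O)) := by
  have hba : topRank P b O < topRank P a O := by omega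
  have hw' : Waiting P (O.erase (topObj P a O)) k (σ.eraseIdx j) := by
    refine (prefixAll_eraseIdx_iff hkj.le).2 fun i hi c hc => ?_
    exact lt_topRank_erase hP hO (by omega) (hw i hi c hc)
  have hb' : (σ.eraseIdx j)[k]? = some b := by rw [List.getElem?_eraseIdx, if_pos hkj, hb]
  have ha' : (σ.eraseIdx k)[j - 1]? = some a := by
    rw [List.getElem?_eraseIdx, if_neg (by omega), ← ha]
    congr 1
    omega
  simp only [PicksAt, ha, ha', Option.some_inj, exists_eq_left']
  rw [crawlsTo_iff hb' hw' (by rwa [topRank_erase_of_lt hO hba]),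
    topObj_erase_of_topRank_ne hO hba.ne, topObj_erase_of_topRank_ne hO hba.ne',
    eraseIdx_eraseIdx_of_lt σ hkj, Finset.erase_right_comm]
  tauto

/-- A waiting agent at position `t` and her successor, who wants an object further to the left,
can move in either order. -/
theorem picksAt_iff_of_succ (hP : SinglePeaked P) (hO : O.Nonempty) {t : ℕ} {a b : Fin n}
    (ha : σ[t]? = some a) (hb : σ[t + 1]? = some b) (hw : Waiting P O (t + 1) σ)
    (hbt : topRank P b O ≤ t) :
    PicksAt P x t σ O ↔
      topObj P b O = x b ∧ PicksAt P x t (σ.eraseIdx (t + 1)) (O.erase (topObj P b O)) := by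
  have hat : t < topRank P a O := hw t t.lt_succ_self a ha
  have hba : topRank P b O < topRank P a O := by omega
  have hw' : Waiting P (O.erase (topObj P a O)) t (σ.eraseIdx t) := by
    refine (prefixAll_eraseIdx_iff le_rfl).2 fun i hi c hc => ?_
    exact lt_topRank_erase hP hO (by omega) (hw i (by omega) c hc)
  have hb' : (σ.eraseIdx t)[t]? = some b := by
    rw [List.getElem?_eraseIdx, if_neg (lt_irrefl t), hb]
  have ha' : (σ.eraseIdx (t + 1))[t]? = some a := by
    rw [List.getElem?_eraseIdx, if_pos t.lt_succ_self, ha]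
  simp only [PicksAt, ha, ha', Option.some_inj, exists_eq_left']
  rw [crawlsTo_iff hb' hw' (by rwa [topRank_erase_of_lt hO hba]),
    topObj_erase_of_topRank_ne hO hba.ne, topObj_erase_of_topRank_ne hO hba.ne',
    eraseIdx_eraseIdx_of_lt σ t.lt_add_one, Nat.add_sub_cancel, Finset.erase_right_comm]
  tauto

end Crawl

/-! ### The counting argument -/

/-- Suppose that the agents at positions `i ≤ j` are only required to lie in sets `S i` between
`{i < topRank}` and `{i ≤ topRank}`. Then the crawler yields `x` as often as the procedure in which
the agent at position `j` picks first and the crawler is applied to the other agents. -/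
def PrefixLaw {n : ℕ} (P : Fin n → Equiv.Perm (Fin n)) (x : Fin n → Fin n) (m : ℕ) : Prop :=
  ∀ A O : Finset (Fin n), A.card = m → O.card = m → ∀ j < m, ∀ S : ℕ → Fin n → Prop,
    (∀ i ≤ j, ∀ a, i < topRank P a O → S i a) → (∀ i ≤ j, ∀ a, S i a → i ≤ topRank P a O) →
    orderCount A (fun σ => PrefixAll S (j + 1) σ ∧ CrawlsTo P x σ O) =
      orderCount A (fun σ => PrefixAll S (j + 1) σ ∧ PicksAt P x j σ O)

section Counting

variable {n : ℕ} {P : Fin n → Equiv.Perm (Fin n)} {x : Fin n → Fin n} {A O : Finset (Fin n)}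

theorem topRank_erase_bounds (hP : SinglePeaked P) (hO : O.Nonempty) (a b : Fin n) :
    topRank P a (O.erase (topObj P b O)) ≤ topRank P a O ∧
      topRank P a O ≤ topRank P a (O.erase (topObj P b O)) + 1 := by
  rcases lt_trichotomy (topRank P a O) (topRank P b O) with h | h | h
  · rw [topRank_erase_of_lt hO h]
    omega
  · exact topRank_erase_of_eq hP hO h
  · rw [topRank_erase_of_gt hO h]
    omega

theorem exists_getElem?_eq_some {α : Type*} {σ : List α} {k : ℕ} (h : k < σ.length) :
    ∃ b, σ[k]? = some b :=
  ⟨_, List.getElem?_eq_getElem h⟩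

theorem orderCount_waiting_picksAt_succ (hP : SinglePeaked P) {m t : ℕ} (ih : PrefixLaw P x m)
    (hA : A.card = m + 1) (hO : O.card = m + 1) (ht : t < m) :
    orderCount A (fun σ => Waiting P O (t + 1) σ ∧ PicksAt P x (t + 1) σ O) =
      orderCount A (fun σ => Waiting P O (t + 1) σ ∧ PicksAt P x t σ O) := by
  have hne : O.Nonempty := Finset.card_pos.1 (by omega)
  let R : List (Fin n) → Prop := fun σ => ∀ b, σ[t + 1]? = some b → topRank P b O ≤ t
  rw [orderCount_eq_add A _ R, orderCount_eq_add A (fun σ => _ ∧ PicksAt P x t σ O) R]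
  congr 1
  · have h1 : orderCount A (fun σ => (Waiting P O (t + 1) σ ∧ PicksAt P x (t + 1) σ O) ∧ R σ) =
        orderCount A (fun σ => ∃ b, σ[t + 1]? = some b ∧
          ((topRank P b O ≤ t ∧ topObj P b O = x b) ∧ Waiting P O (t + 1) (σ.eraseIdx (t + 1)) ∧
            CrawlsTo P x (σ.eraseIdx (t + 1)) (O.erase (topObj P b O)))) := by
      refine orderCount_congr_of_length fun σ hσ => ?_
      obtain ⟨b, hb⟩ := exists_getElem?_eq_some (σ := σ) (k := t + 1) (by omega)
      simp only [R, PicksAt, hb, Option.some_inj, exists_eq_left', forall_eq', Waiting,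
        prefixAll_eraseIdx_iff le_rfl]
      tauto
    have h2 : orderCount A (fun σ => (Waiting P O (t + 1) σ ∧ PicksAt P x t σ O) ∧ R σ) =
        orderCount A (fun σ => ∃ b, σ[t + 1]? = some b ∧
          ((topRank P b O ≤ t ∧ topObj P b O = x b) ∧ Waiting P O (t + 1) (σ.eraseIdx (t + 1)) ∧
            PicksAt P x t (σ.eraseIdx (t + 1)) (O.erase (topObj P b O)))) := by
      refine orderCount_congr_of_length fun σ hσ => ?_
      obtain ⟨a, ha⟩ := exists_getElem?_eq_some (σ := σ) (k := t) (by omega)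
      obtain ⟨b, hb⟩ := exists_getElem?_eq_some (σ := σ) (k := t + 1) (by omega)
      have := fun hw hbt => picksAt_iff_of_succ (x := x) hP hne ha hb hw hbt
      simp only [R, hb, Option.some_inj, exists_eq_left', forall_eq']
      have hw : Waiting P O (t + 1) (σ.eraseIdx (t + 1)) ↔ Waiting P O (t + 1) σ :=
        prefixAll_eraseIdx_iff le_rfl
      rw [hw]
      tauto
    rw [h1, h2, orderCount_eraseIdx (by omega) fun b τ => (topRank P b O ≤ t ∧ topObj P b O = x b) ∧
        Waiting P O (t + 1) τ ∧ CrawlsTo P x τ (O.erase (topObj P b O)),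
      orderCount_eraseIdx (by omega) fun b τ => (topRank P b O ≤ t ∧ topObj P b O = x b) ∧
        Waiting P O (t + 1) τ ∧ PicksAt P x t τ (O.erase (topObj P b O))]
    refine Finset.sum_congr rfl fun b hb => ?_
    by_cases hbt : topRank P b O ≤ t ∧ topObj P b O = x b
    · simp only [hbt, true_and, and_self]
      rw [← hbt.2]
      refine ih _ _ (by rw [Finset.card_erase_of_mem hb, hA]; rfl) (card_erase_topObj P b hO)
        t ht _ (fun i _ a ha => ?_) (fun i _ a ha => ?_)
      · exact ha.trans_le (topRank_erase_bounds hP hne a b).1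
      · have := (topRank_erase_bounds hP hne a b).2
        omega
    · simp only [hbt, false_and]
  · have h1 : orderCount A (fun σ => (Waiting P O (t + 1) σ ∧ PicksAt P x (t + 1) σ O) ∧ ¬ R σ) =
        orderCount A (fun σ => ∃ b, σ[t + 1]? = some b ∧
          (t < topRank P b O ∧ topObj P b O = x b ∧ Waiting P O (t + 1) (σ.eraseIdx (t + 1)) ∧
            CrawlsTo P x (σ.eraseIdx (t + 1)) (O.erase (topObj P b O)))) := by
      refine orderCount_congr_of_length fun σ hσ => ?_
      obtain ⟨b, hb⟩ := exists_getElem?_eq_some (σ := σ) (k := t + 1) (by omega)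
      simp only [R, PicksAt, hb, Option.some_inj, exists_eq_left', forall_eq', Waiting,
        prefixAll_eraseIdx_iff le_rfl, not_le]
      tauto
    have h2 : orderCount A (fun σ => (Waiting P O (t + 1) σ ∧ PicksAt P x t σ O) ∧ ¬ R σ) =
        orderCount A (fun σ => ∃ b, σ[t]? = some b ∧
          (t < topRank P b O ∧ topObj P b O = x b ∧ Waiting P O (t + 1) (σ.eraseIdx t) ∧
            CrawlsTo P x (σ.eraseIdx t) (O.erase (topObj P b O)))) := by
      refine orderCount_congr_of_length fun σ hσ => ?_
      obtain ⟨a, ha⟩ := exists_getElem?_eq_some (σ := σ) (k := t) (by omega)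
      obtain ⟨b, hb⟩ := exists_getElem?_eq_some (σ := σ) (k := t + 1) (by omega)
      have hb' : (σ.eraseIdx t)[t]? = some b := by
        rw [List.getElem?_eraseIdx, if_neg (lt_irrefl t), hb]
      simp only [R, PicksAt, ha, hb, Option.some_inj, exists_eq_left', forall_eq', Waiting,
        prefixAll_succ_iff ha, prefixAll_succ_iff hb', prefixAll_eraseIdx_iff le_rfl, not_le]
      tauto
    rw [h1, h2, orderCount_eraseIdx (by omega) fun b τ => t < topRank P b O ∧ topObj P b O = x b ∧
        Waiting P O (t + 1) τ ∧ CrawlsTo P x τ (O.erase (topObj P b O)),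
      orderCount_eraseIdx (by omega) fun b τ => t < topRank P b O ∧ topObj P b O = x b ∧
        Waiting P O (t + 1) τ ∧ CrawlsTo P x τ (O.erase (topObj P b O))]

theorem not_waiting_of_card {σ : List (Fin n)} {m : ℕ} (hσ : σ.length = m + 1)
    (hO : O.card = m + 1) : ¬ Waiting P O (m + 1) σ := by
  intro hw
  obtain ⟨b, hb⟩ := exists_getElem?_eq_some (σ := σ) (k := m) (by omega)
  have h1 := hw m m.lt_succ_self b hb
  have h2 := topRank_lt_card P b (O := O) (Finset.card_pos.1 (by omega))
  omega

theorem orderCount_waiting_crawlsTo (hP : SinglePeaked P) {m t : ℕ} (ih : PrefixLaw P x m)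
    (hA : A.card = m + 1) (hO : O.card = m + 1) (ht : t ≤ m) :
    orderCount A (fun σ => Waiting P O t σ ∧ CrawlsTo P x σ O) =
      orderCount A (fun σ => Waiting P O t σ ∧ PicksAt P x t σ O) := by
  induction ht using Nat.decreasingInduction with
  | self =>
    refine orderCount_congr_of_length fun σ hσ => and_congr_right fun hw => ?_
    obtain ⟨b, hb⟩ := exists_getElem?_eq_some (σ := σ) (k := m) (by omega)
    have := topRank_lt_card P b (O := O) (Finset.card_pos.1 (by omega))
    exact crawlsTo_iff_picksAt hb hw (by omega)
  | of_succ t ht iht =>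
    rw [orderCount_waiting_picksAt_succ hP ih hA hO ht] at iht
    rw [orderCount_eq_add A _ (Waiting P O (t + 1)),
      orderCount_eq_add A (fun σ => _ ∧ PicksAt P x t σ O) (Waiting P O (t + 1))]
    have hmono : ∀ σ, Waiting P O (t + 1) σ → Waiting P O t σ := fun σ h => h.mono t.le_succ
    congr 1
    · convert iht using 3 with σ σ
      · have := hmono σ
        tauto
      · have := hmono σ
        tauto
    · refine orderCount_congr_of_length fun σ hσ => and_congr_left fun hnot =>
        and_congr_right fun hw => ?_
      obtain ⟨b, hb⟩ := exists_getElem?_eq_some (σ := σ) (k := t) (by omega)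
      rw [Waiting, prefixAll_succ_iff hb] at hnot
      exact crawlsTo_iff_picksAt hb hw (not_lt.1 fun h => hnot ⟨hw, h⟩)

/-- The inductive step of `prefixLaw`, for those orders in which the agent at position `k < j` is
the first to move. -/
theorem orderCount_first_mover (hP : SinglePeaked P) {m j k : ℕ} (ih : PrefixLaw P x m)
    (hA : A.card = m + 1) (hO : O.card = m + 1) (hj : j < m + 1) (hk : k < j)
    {S : ℕ → Fin n → Prop} (hS : ∀ i ≤ j, ∀ a, i < topRank P a O → S i a)
    (hS' : ∀ i ≤ j, ∀ a, S i a → i ≤ topRank P a O) :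
    orderCount A (fun σ => ((PrefixAll S (j + 1) σ ∧ Waiting P O k σ) ∧ CrawlsTo P x σ O) ∧
        ¬ Waiting P O (k + 1) σ) =
      orderCount A (fun σ => ((PrefixAll S (j + 1) σ ∧ Waiting P O k σ) ∧ PicksAt P x j σ O) ∧
        ¬ Waiting P O (k + 1) σ) := by
  have hne : O.Nonempty := Finset.card_pos.1 (by omega)
  let T : ℕ → Fin n → Prop := fun i a => S i a ∧ (i < k → i < topRank P a O)
  let T' : ℕ → Fin n → Prop := fun i => if i < k then T i else T (i + 1)
  have hT : ∀ σ b, σ[k]? = some b → ((PrefixAll S (j + 1) σ ∧ Waiting P O k σ) ↔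
      S k b ∧ PrefixAll T' j (σ.eraseIdx k)) := by
    intro σ b hb
    have h1 : (PrefixAll S (j + 1) σ ∧ Waiting P O k σ) ↔ PrefixAll T (j + 1) σ :=
      ⟨fun h i hi a ha => ⟨h.1 i hi a ha, fun hik => h.2 i hik a ha⟩,
        fun h => ⟨fun i hi a ha => (h i hi a ha).1,
          fun i hi a ha => (h i (by omega) a ha).2 hi⟩⟩
    rw [h1, prefixAll_succ_iff_eraseIdx hb hk.le]
    simp [T, T']
  have h1 : orderCount A (fun σ => ((PrefixAll S (j + 1) σ ∧ Waiting P O k σ) ∧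
        CrawlsTo P x σ O) ∧ ¬ Waiting P O (k + 1) σ) =
      orderCount A (fun σ => ∃ b, σ[k]? = some b ∧
        ((topRank P b O ≤ k ∧ topObj P b O = x b ∧ S k b) ∧ PrefixAll T' j (σ.eraseIdx k) ∧
          CrawlsTo P x (σ.eraseIdx k) (O.erase (topObj P b O)))) := by
    refine orderCount_congr_of_length fun σ hσ => ?_
    obtain ⟨b, hb⟩ := exists_getElem?_eq_some (σ := σ) (k := k) (by omega)
    have h1 := hT σ b hb
    have h2 : Waiting P O (k + 1) σ ↔ Waiting P O k σ ∧ k < topRank P b O := prefixAll_succ_iff hb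
    have h3 := fun hw hk => crawlsTo_iff (P := P) (O := O) (x := x) hb hw hk
    simp only [hb, Option.some_inj, exists_eq_left']
    constructor
    · rintro ⟨⟨h, hC⟩, hn⟩
      have hbk := not_lt.1 fun h' => hn (h2.2 ⟨h.2, h'⟩)
      exact ⟨⟨hbk, ((h3 h.2 hbk).1 hC).1, (h1.1 h).1⟩, (h1.1 h).2, ((h3 h.2 hbk).1 hC).2⟩
    · rintro ⟨⟨hbk, hx, hs⟩, hp, hC⟩
      have h := h1.2 ⟨hs, hp⟩
      exact ⟨⟨h, (h3 h.2 hbk).2 ⟨hx, hC⟩⟩, fun hw => absurd (h2.1 hw).2 (not_lt.2 hbk)⟩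
  have h2 : orderCount A (fun σ => ((PrefixAll S (j + 1) σ ∧ Waiting P O k σ) ∧
        PicksAt P x j σ O) ∧ ¬ Waiting P O (k + 1) σ) =
      orderCount A (fun σ => ∃ b, σ[k]? = some b ∧
        ((topRank P b O ≤ k ∧ topObj P b O = x b ∧ S k b) ∧ PrefixAll T' j (σ.eraseIdx k) ∧
          PicksAt P x (j - 1) (σ.eraseIdx k) (O.erase (topObj P b O)))) := by
    refine orderCount_congr_of_length fun σ hσ => ?_
    obtain ⟨b, hb⟩ := exists_getElem?_eq_some (σ := σ) (k := k) (by omega)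
    obtain ⟨a, ha⟩ := exists_getElem?_eq_some (σ := σ) (k := j) (by omega)
    have h1 := hT σ b hb
    have h2 : Waiting P O (k + 1) σ ↔ Waiting P O k σ ∧ k < topRank P b O := prefixAll_succ_iff hb
    have h3 := fun hw hbk hak => picksAt_iff_of_lt (x := x) hP hne hk ha hb hw hbk hak
    have h4 : PrefixAll S (j + 1) σ → k < topRank P a O := fun h =>
      hk.trans_le (hS' j le_rfl a (h j j.lt_succ_self a ha))
    simp only [hb, Option.some_inj, exists_eq_left']
    constructor
    · rintro ⟨⟨h, hC⟩, hn⟩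
      have hbk := not_lt.1 fun h' => hn (h2.2 ⟨h.2, h'⟩)
      have hC' := (h3 h.2 hbk (h4 h.1)).1 hC
      exact ⟨⟨hbk, hC'.1, (h1.1 h).1⟩, (h1.1 h).2, hC'.2⟩
    · rintro ⟨⟨hbk, hx, hs⟩, hp, hC⟩
      have h := h1.2 ⟨hs, hp⟩
      exact ⟨⟨h, (h3 h.2 hbk (h4 h.1)).2 ⟨hx, hC⟩⟩,
        fun hw => absurd (h2.1 hw).2 (not_lt.2 hbk)⟩
  rw [h1, h2, orderCount_eraseIdx (by omega) fun b τ =>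
      (topRank P b O ≤ k ∧ topObj P b O = x b ∧ S k b) ∧ PrefixAll T' j τ ∧
        CrawlsTo P x τ (O.erase (topObj P b O)),
    orderCount_eraseIdx (by omega) fun b τ =>
      (topRank P b O ≤ k ∧ topObj P b O = x b ∧ S k b) ∧ PrefixAll T' j τ ∧
        PicksAt P x (j - 1) τ (O.erase (topObj P b O))]
  refine Finset.sum_congr rfl fun b hb => ?_
  by_cases hbk : topRank P b O ≤ k ∧ topObj P b O = x b ∧ S k b
  · simp only [hbk, true_and, and_self]
    rw [← hbk.2.1]
    have hrb : topRank P b O = k := le_antisymm hbk.1 (hS' k hk.le b hbk.2.2)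
    have hj' : j = j - 1 + 1 := by omega
    nth_rewrite 1 2 [hj']
    refine ih _ _ (by rw [Finset.card_erase_of_mem hb, hA]; rfl) (card_erase_topObj P b hO)
      (j - 1) (by omega) T' (fun i hi a ha => ?_) (fun i hi a ha => ?_)
    · have hle := (topRank_erase_bounds hP hne a b).1
      by_cases hik : i < k
      · simp only [T', T, hik, if_true]
        exact ⟨hS i (by omega) a (by omega), fun _ => by omega⟩
      · simp only [T', T, hik, if_false]
        have hgt : topRank P b O < topRank P a O := by omega
        rw [topRank_erase_of_gt hne hgt] at ha
        exact ⟨hS (i + 1) (by omega) a (by omega), fun _ => by omega⟩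
    · by_cases hik : i < k
      · simp only [T', T, hik, if_true] at ha
        have := (topRank_erase_bounds hP hne a b).2
        have := ha.2 trivial
        omega
      · simp only [T', T, hik, if_false] at ha
        have := (topRank_erase_bounds hP hne a b).2
        have := hS' (i + 1) (by omega) a ha.1
        omega
  · simp only [hbk, false_and]

theorem prefixLaw (hP : SinglePeaked P) (x : Fin n → Fin n) (m : ℕ) : PrefixLaw P x m := by
  induction m with
  | zero => exact fun _ _ _ _ j hj => absurd hj (Nat.not_lt_zero j)
  | succ m ih =>
    intro A O hA hO j hj S hS hS'
    suffices h : ∀ k ≤ j + 1,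
        orderCount A (fun σ => (PrefixAll S (j + 1) σ ∧ Waiting P O k σ) ∧ CrawlsTo P x σ O) =
        orderCount A (fun σ => (PrefixAll S (j + 1) σ ∧ Waiting P O k σ) ∧ PicksAt P x j σ O) by
      simpa [Waiting, PrefixAll] using h 0 (Nat.zero_le _)
    intro k hk
    induction hk using Nat.decreasingInduction with
    | self =>
      have hw : ∀ σ, (PrefixAll S (j + 1) σ ∧ Waiting P O (j + 1) σ) ↔ Waiting P O (j + 1) σ :=
        fun σ => and_iff_right_of_imp fun h i hi a ha => hS i (by omega) a (h i hi a ha)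
      simp only [hw]
      rcases Nat.lt_succ_iff_lt_or_eq.1 hj with hj | rfl
      · rw [orderCount_waiting_crawlsTo hP ih hA hO (by omega),
          orderCount_waiting_picksAt_succ hP ih hA hO hj]
      · exact orderCount_congr_of_length fun σ hσ => and_congr_right fun h =>
          absurd h (not_waiting_of_card (by omega) hO)
    | of_succ k hk ihk =>
      rw [orderCount_eq_add A _ (Waiting P O (k + 1)),
        orderCount_eq_add A (fun σ => _ ∧ PicksAt P x j σ O) (Waiting P O (k + 1))]
      have hmono : ∀ σ, Waiting P O (k + 1) σ → Waiting P O k σ := fun σ h => h.mono k.le_succ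
      congr 1
      · convert ihk using 3 with σ σ
        · have := hmono σ
          tauto
        · have := hmono σ
          tauto
      · rcases Nat.lt_succ_iff_lt_or_eq.1 hk with hk | rfl
        · exact orderCount_first_mover hP ih hA hO hj hk hS hS'
        · refine orderCount_congr_of_length fun σ hσ => and_congr_left fun hnot =>
            and_congr_right fun hw => ?_
          obtain ⟨b, hb⟩ := exists_getElem?_eq_some (σ := σ) (k := k) (by omega)
          rw [Waiting, prefixAll_succ_iff hb] at hnot
          exact crawlsTo_iff_picksAt hb hw.2 (not_lt.1 fun h => hnot ⟨hw.2, h⟩)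

/-- Sequential priority in the order `σ` assigns the agents objects from `O` according to `x`. -/
def PriorityTo {n : ℕ} (P : Fin n → Equiv.Perm (Fin n)) (x : Fin n → Fin n) :
    List (Fin n) → Finset (Fin n) → Prop
  | [], _ => True
  | b :: σ, O => topObj P b O = x b ∧ PriorityTo P x σ (O.erase (topObj P b O))

theorem orderCount_crawlsTo_eq_priorityTo (hP : SinglePeaked P) (x : Fin n → Fin n) {m : ℕ}
    (hA : A.card = m) (hO : O.card = m) :
    orderCount A (fun σ => CrawlsTo P x σ O) = orderCount A (fun σ => PriorityTo P x σ O) := by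
  induction m generalizing A O with
  | zero =>
    refine orderCount_congr_of_length fun σ hσ => ?_
    obtain rfl := List.eq_nil_of_length_eq_zero (hσ.trans hA)
    exact iff_of_true (.nil O) trivial
  | succ m ih =>
    have h := orderCount_waiting_crawlsTo hP (prefixLaw hP x m) hA hO (Nat.zero_le m)
    simp only [Waiting, PrefixAll, Nat.not_lt_zero, false_imp_iff, implies_true, true_and] at h
    rw [h]
    unfold PicksAt
    rw [orderCount_eraseIdx (by omega) fun b τ => topObj P b O = x b ∧
      CrawlsTo P x τ (O.erase (topObj P b O))]
    have h' : orderCount A (fun σ => PriorityTo P x σ O) =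
        orderCount A (fun σ => ∃ b, σ[0]? = some b ∧ (topObj P b O = x b ∧
          PriorityTo P x (σ.eraseIdx 0) (O.erase (topObj P b O)))) := by
      refine orderCount_congr_of_length fun σ hσ => ?_
      cases σ with
      | nil => simp at hσ; omega
      | cons b σ => simp [PriorityTo]
    rw [h', orderCount_eraseIdx (by omega) fun b τ => topObj P b O = x b ∧
      PriorityTo P x τ (O.erase (topObj P b O))]
    refine Finset.sum_congr rfl fun b hb => ?_
    by_cases hbx : topObj P b O = x b
    · simp only [hbx, true_and]
      rw [← hbx]
      exact ih (by rw [Finset.card_erase_of_mem hb, hA]; rfl) (card_erase_topObj P b hO)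
    · simp only [hbx, false_and]

end Counting

/-! ### The algorithms and the relations -/

section Algorithms

variable {n : ℕ} {P : Fin n → Equiv.Perm (Fin n)} {x : Fin n → Fin n} {O : Finset (Fin n)}

/-- An agent with single-peaked preferences prefers `o` to the next remaining object `o'` exactly
when her favourite remaining object is not beyond `o`. -/
theorem lt_iff_topObj_le (hP : SinglePeaked P) {a o o' : Fin n} (ho : o ∈ O) (hoo' : o < o')
    (ho' : o' ∈ O) (hnext : ∀ z ∈ O, o < z → o' ≤ z) :
    P a o < P a o' ↔ topObj P a O ≤ o := by
  obtain ⟨hm, hmin⟩ := topObj_spec P a ⟨o, ho⟩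
  obtain ⟨p, hp⟩ := hP a
  constructor
  · intro h
    by_contra! hlt
    rcases le_total o' p with h' | h'
    · exact absurd (hp o' o (Or.inl ⟨hoo', h'⟩)) h.asymm
    · rcases (hnext _ hm hlt).lt_or_eq with h'' | h''
      · exact absurd (hp o' _ (Or.inr ⟨h', h''⟩)) (not_lt.2 (hmin o' ho'))
      · exact absurd h (not_lt.2 (h'' ▸ hmin o ho))
  · intro h
    rcases le_total p o with h' | h'
    · exact hp o o' (Or.inr ⟨h', hoo'⟩)
    · rcases h.lt_or_eq with h'' | h''
      · exact absurd (hp o _ (Or.inl ⟨h'', h'⟩)) (not_lt.2 (hmin o ho))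
      · exact lt_of_le_of_ne (h'' ▸ hmin o' ho') fun h => hoo'.ne ((P a).injective h)

theorem topRank_le_iff (P : Fin n → Equiv.Perm (Fin n)) (a : Fin n) (i : Fin O.card) :
    topRank P a O ≤ i ↔ topObj P a O ≤ O.orderEmbOfFin rfl i := by
  have hm := topObj_mem P a (Finset.card_pos.1 (i.2.trans_le' (Nat.zero_le _)))
  obtain ⟨r, hr⟩ : topObj P a O ∈ Set.range (O.orderEmbOfFin rfl) := by simpa using hm
  have hcard : topRank P a O = r := by
    rw [topRank, ← hr, ← Fin.card_Iio r, ← Finset.card_map (O.orderEmbOfFin rfl).toEmbedding]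
    congr 1
    ext z
    simp only [Finset.mem_filter, Finset.mem_map, Finset.mem_Iio, RelEmbedding.coe_toEmbedding]
    constructor
    · rintro ⟨hz, hlt⟩
      obtain ⟨s, rfl⟩ : z ∈ Set.range (O.orderEmbOfFin rfl) := by simpa using hz
      exact ⟨s, by simpa using hlt, rfl⟩
    · rintro ⟨s, hs, rfl⟩
      exact ⟨Finset.orderEmbOfFin_mem _ _ _, by simpa using hs⟩
  rw [hcard, ← hr, OrderEmbedding.le_iff_le, Fin.le_def]

theorem lt_sort_iff_topRank_le (hP : SinglePeaked P) {a o o' : Fin n} {i : ℕ}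
    (ho : O.sort[i]? = some o) (ho' : O.sort[i + 1]? = some o') :
    P a o < P a o' ↔ topRank P a O ≤ i := by
  obtain ⟨hi, ho⟩ := List.getElem?_eq_some_iff.1 ho
  obtain ⟨hi', ho'⟩ := List.getElem?_eq_some_iff.1 ho'
  rw [Finset.length_sort] at hi hi'
  have ho : O.orderEmbOfFin rfl ⟨i, hi⟩ = o := ho
  have ho' : O.orderEmbOfFin rfl ⟨i + 1, hi'⟩ = o' := ho'
  rw [topRank_le_iff P a ⟨i, hi⟩, ho]
  subst ho ho'
  refine lt_iff_topObj_le hP (Finset.orderEmbOfFin_mem _ _ _) (by simp)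
    (Finset.orderEmbOfFin_mem _ _ _) fun z hz hlt => ?_
  obtain ⟨s, rfl⟩ : z ∈ Set.range (O.orderEmbOfFin rfl) := by simpa using hz
  rw [OrderEmbedding.lt_iff_lt, Fin.lt_def] at hlt
  rw [OrderEmbedding.le_iff_le, Fin.le_def]
  exact hlt

theorem findIdx2_spec (rk : Fin n → Fin n → Fin n) {σ l : List (Fin n)} (h : σ.length = l.length)
    (hσ : σ ≠ []) :
    findIdx2 rk σ l < σ.length ∧
      (∀ i < findIdx2 rk σ l, ∀ a o o', σ[i]? = some a → l[i]? = some o → l[i + 1]? = some o' →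
        ¬ rk a o < rk a o') ∧
      ∀ a o o', σ[findIdx2 rk σ l]? = some a → l[findIdx2 rk σ l]? = some o →
        l[findIdx2 rk σ l + 1]? = some o' → rk a o < rk a o' := by
  induction σ generalizing l with
  | nil => exact absurd rfl hσ
  | cons a σ ih =>
    match l, h with
    | [o], h => simp [findIdx2]
    | o :: o' :: l, h =>
      rw [findIdx2]
      split_ifs with hlt
      · simp [hlt]
      · obtain ⟨h1, h2, h3⟩ := ih (l := o' :: l) (by simpa using h) (by rintro rfl; simp at h)
        refine ⟨by simpa using h1, fun i hi => ?_, by simpa using h3⟩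
        cases i with
        | zero => simpa using hlt
        | succ i => simpa using h2 i (by omega)

theorem findIdx2_sort_spec (hP : SinglePeaked P) {σ : List (Fin n)} {m : ℕ}
    (hσ : σ.length = m + 1) (hO : O.card = m + 1) :
    ∃ b, σ[findIdx2 (fun j => ⇑(P j)) σ O.sort]? = some b ∧
      Waiting P O (findIdx2 (fun j => ⇑(P j)) σ O.sort) σ ∧
      topRank P b O ≤ findIdx2 (fun j => ⇑(P j)) σ O.sort := by
  obtain ⟨h1, h2, h3⟩ := findIdx2_spec (fun j => ⇑(P j)) (σ := σ) (l := O.sort) (by simp [hσ, hO])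
    (by rintro rfl; simp at hσ)
  have hget : ∀ i < m + 1, ∃ o, O.sort[i]? = some o := fun i hi =>
    exists_getElem?_eq_some (by simp [hO, hi])
  generalize findIdx2 (fun j => ⇑(P j)) σ O.sort = t at *
  obtain ⟨b, hb⟩ := exists_getElem?_eq_some h1
  refine ⟨b, hb, fun i hi a ha => ?_, ?_⟩
  · obtain ⟨o, ho⟩ := hget i (by omega)
    obtain ⟨o', ho'⟩ := hget (i + 1) (by omega)
    have := h2 i hi a o o' ha ho ho'
    rwa [lt_sort_iff_topRank_le hP ho ho', not_le] at this
  · by_cases ht : t = m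
    · have := topRank_lt_card P b (O := O) (Finset.card_pos.1 (by omega))
      omega
    · obtain ⟨o, ho⟩ := hget t (by omega)
      obtain ⟨o', ho'⟩ := hget (t + 1) (by omega)
      exact (lt_sort_iff_topRank_le hP ho ho').1 (h3 b o o' hb ho ho')

theorem sort_erase (O : Finset (Fin n)) (o : Fin n) : (O.erase o).sort = O.sort.erase o := by
  refine (List.Perm.eq_of_pairwise' (r := (· ≤ ·)) (Finset.pairwise_sort _ _)
    ((Finset.pairwise_sort O (· ≤ ·)).sublist List.erase_sublist) ?_)
  refine (List.perm_ext_iff_of_nodup (Finset.sort_nodup _ _)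
    ((Finset.sort_nodup _ _).erase _)).2 fun z => ?_
  simp [(Finset.sort_nodup O (· ≤ ·)).mem_erase_iff]

theorem argmin_sort_getD (P : Fin n → Equiv.Perm (Fin n)) (a o : Fin n) (hO : O.Nonempty) :
    (O.sort.argmin (P a)).getD o = topObj P a O := by
  cases h : O.sort.argmin (P a) with
  | some z => simp [topObj, h]
  | none =>
    obtain ⟨z, hz⟩ := hO
    rw [List.argmin_eq_none] at h
    simpa [h] using (Finset.mem_sort (· ≤ ·)).2 hz

theorem crawlAux_spec (hP : SinglePeaked P) {m : ℕ} {σ : List (Fin n)} (hσ : σ.length = m)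
    (hO : O.card = m) :
    ((∀ p ∈ crawlAux (fun j => ⇑(P j)) m σ O.sort, p.2 = x p.1) ↔ CrawlsTo P x σ O) ∧
      ((crawlAux (fun j => ⇑(P j)) m σ O.sort).map Prod.fst).Perm σ := by
  induction m generalizing σ O with
  | zero =>
    obtain rfl := List.eq_nil_of_length_eq_zero hσ
    simp [crawlAux, CrawlsTo.nil]
  | succ m ih =>
    have hne : O.Nonempty := Finset.card_pos.1 (by omega)
    obtain ⟨b, hb, hw, hk⟩ := findIdx2_sort_spec hP hσ hO
    obtain ⟨a0, σ', rfl⟩ := List.exists_cons_of_length_eq_add_one hσ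
    obtain ⟨o0, l, hl⟩ := List.exists_cons_of_length_eq_add_one
      ((Finset.length_sort (· ≤ ·)).trans hO)
    have hrun : crawlAux (fun j => ⇑(P j)) (m + 1) (a0 :: σ') O.sort = (b, topObj P b O) ::
        crawlAux (fun j => ⇑(P j)) m
          ((a0 :: σ').eraseIdx (findIdx2 (fun j => ⇑(P j)) (a0 :: σ') O.sort))
          (O.erase (topObj P b O)).sort := by
      rw [sort_erase, ← argmin_sort_getD P b o0 hne]
      simp only [hl] at hb ⊢
      simp [crawlAux, List.getD_eq_getElem?_getD, hb]
    rw [hrun, crawlsTo_iff hb hw hk]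
    obtain ⟨ih1, ih2⟩ := ih (σ := (a0 :: σ').eraseIdx _) (O := O.erase (topObj P b O))
      (by
        rw [List.length_eraseIdx_of_lt (List.getElem?_eq_some_iff.1 hb).1, hσ]
        rfl) (card_erase_topObj P b hO)
    obtain ⟨hlt, hb⟩ := List.getElem?_eq_some_iff.1 hb
    refine ⟨by rw [List.forall_mem_cons, ih1], ?_⟩
    rw [List.map_cons]
    refine (ih2.cons _).trans ?_
    have := List.getElem_cons_eraseIdx_perm hlt
    rwa [hb] at this

theorem SPAux_spec (σ : List (Fin n)) (hO : O.card = σ.length) :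
    ((∀ p ∈ SPAux (fun j => ⇑(P j)) σ O.sort, p.2 = x p.1) ↔ PriorityTo P x σ O) ∧
      (SPAux (fun j => ⇑(P j)) σ O.sort).map Prod.fst = σ := by
  induction σ generalizing O with
  | nil => simp [SPAux, PriorityTo]
  | cons b σ ih =>
    have hne : O.Nonempty := Finset.card_pos.1 (by simp [hO])
    obtain ⟨o0, l, hl⟩ := List.exists_cons_of_length_eq_add_one
      ((Finset.length_sort (· ≤ ·)).trans hO)
    have hrun : SPAux (fun j => ⇑(P j)) (b :: σ) O.sort = (b, topObj P b O) ::
        SPAux (fun j => ⇑(P j)) σ (O.erase (topObj P b O)).sort := by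
      rw [sort_erase, ← argmin_sort_getD P b o0 hne]
      simp only [hl]
      simp [SPAux]
    obtain ⟨ih1, ih2⟩ := ih (card_erase_topObj P b hO)
    rw [hrun, List.forall_mem_cons, ih1, List.map_cons, ih2]
    exact ⟨Iff.rfl, rfl⟩

theorem sort_univ (n : ℕ) : (Finset.univ : Finset (Fin n)).sort = List.finRange n := by
  refine (List.Perm.eq_of_pairwise' (r := (· ≤ ·)) (Finset.pairwise_sort _ _)
    ((List.pairwise_lt_finRange n).imp le_of_lt) ?_)
  refine (List.perm_ext_iff_of_nodup (Finset.sort_nodup _ _) (List.nodup_finRange n)).2 fun z => ?_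
  simp

/-- An allocation read off from a list of assignments in which every agent appears exactly
once. -/
theorem lookup_getD_eq_iff {L : List (Fin n × Fin n)} (hL : (L.map Prod.fst).Nodup)
    (hmem : ∀ i, i ∈ L.map Prod.fst) (d : Fin n → Fin n) :
    (fun i => (L.lookup i).getD (d i)) = x ↔ ∀ p ∈ L, p.2 = x p.1 := by
  have key : ∀ p ∈ L, L.lookup p.1 = some p.2 := by
    clear hmem
    induction L with
    | nil => simp
    | cons q L ih =>
      rw [List.map_cons, List.nodup_cons] at hL
      rintro p hp
      rcases List.mem_cons.1 hp with rfl | hp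
      · exact List.lookup_cons_self
      · have hpq : p.1 ≠ q.1 := fun h => hL.1 (h ▸ List.mem_map_of_mem hp)
        rw [List.lookup_cons, beq_eq_false_iff_ne.2 hpq]
        exact ih hL.2 p hp
  rw [funext_iff]
  constructor
  · intro h p hp
    simpa [key p hp] using h p.1
  · intro h i
    obtain ⟨p, hp, rfl⟩ := List.mem_map.1 (hmem i)
    simpa [key p hp] using h p hp

theorem map_finRange_perm (f : Equiv.Perm (Fin n)) :
    ((List.finRange n).map f).Perm (List.finRange n) :=
  (List.perm_ext_iff_of_nodup ((List.nodup_finRange n).map f.injective)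
    (List.nodup_finRange n)).2 fun i => by simpa using ⟨f.symm i, by simp⟩

theorem ownersList_eq (ω : Equiv.Perm (Fin n)) :
    ownersList ⇑ω = (List.finRange n).map ω.symm := by
  have h : ∀ o, ((List.finRange n).find? fun a => ω a == o) = some (ω.symm o) := by
    intro o
    cases hf : (List.finRange n).find? fun a => ω a == o with
    | none =>
      rw [List.find?_eq_none] at hf
      simpa using hf (ω.symm o) (List.mem_finRange _)
    | some a =>
      have := List.find?_some hf
      simp only [beq_iff_eq] at this
      rw [← this, Equiv.symm_apply_apply]
  simp only [ownersList, h]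
  rw [List.filterMap_eq_map']

theorem CRfun_eq_iff (hP : SinglePeaked P) (ω : Equiv.Perm (Fin n)) :
    CRfun (fun j => ⇑(P j)) ⇑ω = x ↔
      CrawlsTo P x ((List.finRange n).map ω.symm) Finset.univ := by
  obtain ⟨h1, h2⟩ := crawlAux_spec (x := x) (m := n) hP (σ := (List.finRange n).map ω.symm)
    (O := Finset.univ) (by simp) (by simp)
  rw [← h1]
  rw [sort_univ] at h2 ⊢
  have h3 := h2.trans (map_finRange_perm ω.symm)
  rw [← ownersList_eq] at h3 ⊢
  exact lookup_getD_eq_iff (h3.nodup_iff.2 (List.nodup_finRange n))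
    (fun i => h3.mem_iff.2 (List.mem_finRange i)) ω

theorem SPfun_eq_iff (f : Equiv.Perm (Fin n)) :
    SPfun (fun j => ⇑(P j)) ⇑f = x ↔ PriorityTo P x ((List.finRange n).map f) Finset.univ := by
  obtain ⟨h1, h2⟩ := SPAux_spec (P := P) (x := x) ((List.finRange n).map f) (O := Finset.univ)
    (by simp)
  rw [← h1]
  rw [sort_univ] at h2 ⊢
  have h3 := (List.Perm.of_eq h2).trans (map_finRange_perm f)
  exact lookup_getD_eq_iff (h3.nodup_iff.2 (List.nodup_finRange n))
    (fun i => h3.mem_iff.2 (List.mem_finRange i)) fun i => i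

open Classical in
theorem orderCount_univ (Q : List (Fin n) → Prop) :
    orderCount Finset.univ Q =
      (Finset.univ.filter fun f : Equiv.Perm (Fin n) => Q ((List.finRange n).map f)).card := by
  symm
  refine Finset.card_bij (fun f _ => (List.finRange n).map f) ?_ ?_ ?_
  · intro f hf
    simp only [Finset.mem_filter, Multiset.mem_toFinset, Multiset.mem_lists_iff] at hf ⊢
    refine ⟨?_, hf.2⟩
    exact (Multiset.coe_eq_coe.2 (map_finRange_perm f)).symm
  · intro f _ g _ h
    ext1 i
    exact List.map_inj_left.1 h i (List.mem_finRange i)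
  · intro σ hσ
    simp only [Finset.mem_filter, Multiset.mem_toFinset, Multiset.mem_lists_iff] at hσ
    have hperm : (List.finRange n).Perm σ := Multiset.coe_eq_coe.1 hσ.1
    have hlen : σ.length = n := by simpa using hperm.length_eq.symm
    have hinj : Function.Injective fun i : Fin n => σ[i] := fun i j h => by
      simpa [Fin.ext_iff] using
        (hperm.nodup_iff.1 (List.nodup_finRange n)).getElem_inj_iff.1 h
    have hmap : (List.finRange n).map (Equiv.ofBijective _ (Finite.injective_iff_bijective.1 hinj)) =
        σ := List.ext_getElem (by simp [hlen]) (by simp)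
    exact ⟨_, by simpa only [Finset.mem_filter_univ, hmap] using hσ.2, hmap⟩

end Algorithms

/-- the crawler from random endowments equals the random priority rule:
for every allocation `x`, the number of endowment profiles `ω` with `CR(P,ω) = x`
equals the number of orders `f` on the agent set with `SP^f(P) = x`. -/
theorem crawler_from_random_endowments_eq_random_priority {n : ℕ} (hn : 1 ≤ n)
    (P : Fin n → Equiv.Perm (Fin n)) (hP : SinglePeaked P) (x : Equiv.Perm (Fin n)) :
    (Finset.univ.filter fun ω : Equiv.Perm (Fin n) => CRfun (fun j => ⇑(P j)) ⇑ω = ⇑x).card =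
      (Finset.univ.filter fun f : Equiv.Perm (Fin n) => SPfun (fun j => ⇑(P j)) ⇑f = ⇑x).card := by
  classical
  have h := orderCount_crawlsTo_eq_priorityTo hP x (A := Finset.univ) (O := Finset.univ)
    rfl rfl
  rw [orderCount_univ, orderCount_univ] at h
  simp only [CRfun_eq_iff hP, SPfun_eq_iff]
  rw [← h]
  exact Finset.card_equiv (Equiv.symmEquiv _ _) fun ω => by
    simp only [Finset.mem_filter_univ]
    rfl
end
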